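/- Let A ∈ ℝ^{m×n}, b ∈ ℝᵐ, and λ ∈ ℝⁿ with λ_1 ≥ λ_2 ≥ ⋯ ≥ λ_n ≥ 0. Then weak duality holds between the SLOPE primal and its dual: for every x ∈ ℝⁿ and every y ∈ ℝᵐ with −Aᵀy ∈ C_λ, one has ½‖Ax − b‖² + κ_λ(x) ≥ −⟨b, y⟩ − ½‖y‖². -/

import Mathlib

open Matrix

/-- `absDown x` is the vector of the absolute values of the entries of `x`
arranged in non-increasing order, i.e. `|x|^↓`. -/
noncomputable def absDown {n : ℕ} (x : Fin n → ℝ) : Fin n → ℝ :=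
  fun i => |x (Tuple.sort (fun k => -|x k|) i)|

/-- The decreasing weighted sorted ℓ₁ (DWSL1) function `κ_λ(x) = ∑ λ_i |x|_i^↓`. -/
noncomputable def kappa {n : ℕ} (lam x : Fin n → ℝ) : ℝ :=
  ∑ i, lam i * absDown x i

/-- A signed permutation matrix: exactly one nonzero entry in each row and
each column, and every entry is `0`, `1` or `-1`. -/
def IsSignedPerm {n : ℕ} (π : Matrix (Fin n) (Fin n) ℝ) : Prop :=
  (∀ i, ∃! j, π i j ≠ 0) ∧ (∀ j, ∃! i, π i j ≠ 0) ∧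
    ∀ i j, π i j = 0 ∨ π i j = 1 ∨ π i j = -1

/-- The matrix `B` with `(Bx)_i = x_i - x_{i+1}` for `i < n-1` and `(Bx)_{n-1} = x_{n-1}`. -/
def Bmat (n : ℕ) : Matrix (Fin n) (Fin n) ℝ :=
  Matrix.of fun i j => if j = i then 1 else if (j : ℕ) = (i : ℕ) + 1 then -1 else 0

/-- `B_Γ`: the submatrix of `B` consisting of the rows indexed by `Γ`. -/
def Brows {n : ℕ} (Γ : Finset (Fin n)) : Matrix {i // i ∈ Γ} (Fin n) ℝ :=
  Matrix.of fun i j => Bmat n i.1 j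

/-- `P = Iₙ - B_Γᵀ (B_Γ B_Γᵀ)⁻¹ B_Γ`. -/
noncomputable def Pmat {n : ℕ} (Γ : Finset (Fin n)) : Matrix (Fin n) (Fin n) ℝ :=
  1 - (Brows Γ)ᵀ * (Brows Γ * (Brows Γ)ᵀ)⁻¹ * Brows Γ

/-- The Euclidean norm on `Fin n → ℝ`. -/
noncomputable def eucNorm {n : ℕ} (x : Fin n → ℝ) : ℝ := Real.sqrt (∑ i, (x i) ^ 2)

/-- Membership in the set `C_λ = {z : ∑_{j ≤ i} |z|_j^↓ ≤ ∑_{j ≤ i} λ_j for all i}`. -/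
def memC {n : ℕ} (lam z : Fin n → ℝ) : Prop :=
  ∀ i : Fin n, ∑ j ∈ Finset.Iic i, absDown z j ≤ ∑ j ∈ Finset.Iic i, lam j

/-- Abel's inequality: if all partial sums of `d` are nonnegative and `w` is non-increasing, then
the weighted sum of `d` is at least its total sum times the last weight. -/
theorem last_mul_sum_le_sum_mul_of_antitone {n : ℕ} (w d : Fin (n + 1) → ℝ) (hw : Antitone w)
    (hd : ∀ i, 0 ≤ ∑ j, if j ≤ i then d j else 0) :
    w (Fin.last n) * ∑ i, d i ≤ ∑ i, w i * d i := by
  induction n with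
  | zero => simp
  | succ n ih =>
    have hd' : ∀ i : Fin (n + 1), 0 ≤ ∑ j : Fin (n + 1), if j ≤ i then d j.castSucc else 0 := by
      intro i
      have h := hd i.castSucc
      rw [Fin.sum_univ_castSucc] at h
      simpa [(Fin.castSucc_lt_last i).not_ge] using h
    have hih := ih (fun i => w i.castSucc) (fun i => d i.castSucc)
      (fun i j hij => hw (Fin.castSucc_le_castSucc_iff.2 hij)) hd'
    have hsum : 0 ≤ ∑ i : Fin (n + 1), d i.castSucc := by
      simpa [Fin.le_last] using hd' (Fin.last n)
    have hstep := mul_le_mul_of_nonneg_right (hw (Fin.le_last (Fin.last n).castSucc)) hsum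
    rw [Fin.sum_univ_castSucc d, Fin.sum_univ_castSucc fun i => w i * d i, mul_add]
    linarith

theorem sum_mul_le_sum_mul_of_antitone {n : ℕ} (w f g : Fin n → ℝ) (hw : Antitone w)
    (hw0 : ∀ i, 0 ≤ w i)
    (h : ∀ i, ∑ j ∈ Finset.Iic i, f j ≤ ∑ j ∈ Finset.Iic i, g j) :
    ∑ i, w i * f i ≤ ∑ i, w i * g i := by
  cases n with
  | zero => simp
  | succ n =>
    have hd : ∀ i, 0 ≤ ∑ j, if j ≤ i then g j - f j else 0 := by
      intro i
      rw [← Finset.sum_filter, Finset.filter_ge_eq_Iic, Finset.sum_sub_distrib]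
      exact sub_nonneg.2 (h i)
    have hsum : 0 ≤ ∑ i, (g i - f i) := by simpa [Fin.le_last] using hd (Fin.last n)
    have hlast := last_mul_sum_le_sum_mul_of_antitone w (fun i => g i - f i) hw hd
    have hnonneg := mul_nonneg (hw0 (Fin.last n)) hsum
    simp only [mul_sub, Finset.sum_sub_distrib] at hlast hnonneg
    linarith

theorem absDown_nonneg {n : ℕ} (x : Fin n → ℝ) (i : Fin n) : 0 ≤ absDown x i := abs_nonneg _

theorem absDown_antitone {n : ℕ} (x : Fin n → ℝ) : Antitone (absDown x) := fun _ _ hij =>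
  neg_le_neg_iff.1 (Tuple.monotone_sort (fun k => -|x k|) hij)

/-- The rearrangement inequality for absolute values. -/
theorem sum_mul_le_sum_absDown_mul {n : ℕ} (x z : Fin n → ℝ) :
    ∑ i, x i * z i ≤ ∑ i, absDown x i * absDown z i := by
  set σ := Tuple.sort (fun k => -|x k|) with hσ
  set τ := Tuple.sort (fun k => -|z k|) with hτ
  calc ∑ i, x i * z i ≤ ∑ i, |x i| * |z i| :=
        Finset.sum_le_sum fun i _ => (le_abs_self _).trans_eq (abs_mul _ _)
    _ = ∑ i, |x (σ i)| * |z (σ i)| := (Equiv.sum_comp σ fun i => |x i| * |z i|).symm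
    _ = ∑ i, absDown x i * absDown z ((σ.trans τ.symm) i) := by
        simp [absDown, ← hσ, ← hτ]
    _ ≤ ∑ i, absDown x i * absDown z i :=
        ((absDown_antitone x).monovary (absDown_antitone z)).sum_mul_comp_perm_le_sum_mul

/-- `κ_λ` dominates the support function of `C_λ`. -/
theorem sum_mul_le_kappa {n : ℕ} (lam x z : Fin n → ℝ) (hz : memC lam z) :
    ∑ i, x i * z i ≤ kappa lam x :=
  calc ∑ i, x i * z i ≤ ∑ i, absDown x i * absDown z i := sum_mul_le_sum_absDown_mul x z
    _ ≤ ∑ i, absDown x i * lam i :=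
        sum_mul_le_sum_mul_of_antitone _ _ _ (absDown_antitone x) (absDown_nonneg x) hz
    _ = kappa lam x := Finset.sum_congr rfl fun _ _ => mul_comm _ _

/-- Weak duality between the SLOPE primal and its dual. -/
theorem stmt16 {m n : ℕ} (A : Matrix (Fin m) (Fin n) ℝ) (b : Fin m → ℝ)
    (lam : Fin n → ℝ) (hmono : Antitone lam) (hpos : ∀ i, 0 ≤ lam i)
    (x : Fin n → ℝ) (y : Fin m → ℝ) (hfeas : memC lam (-(Aᵀ.mulVec y))) :
    -(∑ i, b i * y i) - (1 / 2) * ∑ i, (y i) ^ 2 ≤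
      (1 / 2) * ∑ i, (A.mulVec x i - b i) ^ 2 + kappa lam x := by
  have hkappa := sum_mul_le_kappa lam x _ hfeas
  have hadj : ∑ i, x i * (-(Aᵀ.mulVec y)) i = -∑ i, A.mulVec x i * y i := by
    change x ⬝ᵥ (-(Aᵀ *ᵥ y)) = -((A *ᵥ x) ⬝ᵥ y)
    rw [dotProduct_neg, dotProduct_mulVec, vecMul_transpose]
  have hsq : 0 ≤ ∑ i, (A.mulVec x i - b i - y i) ^ 2 := Finset.sum_nonneg fun i _ => sq_nonneg _
  have hexp : ∑ i, (A.mulVec x i - b i - y i) ^ 2 = ∑ i, (A.mulVec x i - b i) ^ 2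
      + ∑ i, (y i) ^ 2 + 2 * ∑ i, b i * y i - 2 * ∑ i, A.mulVec x i * y i := by
    simp only [Finset.mul_sum, ← Finset.sum_add_distrib, ← Finset.sum_sub_distrib]
    exact Finset.sum_congr rfl fun i _ => by ring
  linarith
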